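/- arXiv:2201.08045 — 6 statements merged into one kernel-verified Lean document; each statement's English description precedes it below -/
import Mathlib

section
/- Let Z = (Z_1, …, Z_d) be a d-tuple of n×n complex matrices and let ε > 0. Then there exists an invertible n×n complex matrix S such that the d-tuple W with W_j = S Z_j S^{-1} satisfies ‖W‖_col ≤ ‖Z‖_row + ε; conversely, there exists an invertible S' such that the tuple W' with W'_j = S' Z_j S'^{-1} satisfies ‖W'‖_row ≤ ‖Z‖_col + ε. If moreover Z is irreducible, one may take ε = 0 in both statements. In particular, any strict row contraction is jointly similar to a strict column contraction and any strict column contraction is jointly similar to a strict row contraction. -/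
open Matrix
open scoped ComplexOrder

/-- The operator norm (ℓ² → ℓ² norm) of a complex `n × n` matrix. -/
noncomputable def opNorm {n : ℕ} (M : Matrix (Fin n) (Fin n) ℂ) : ℝ :=
  ‖Matrix.toEuclideanCLM (𝕜 := ℂ) M‖

/-- The row norm of a `d`-tuple of matrices: `‖Z₁Z₁ᴴ + ⋯ + Z_dZ_dᴴ‖^{1/2}`. -/
noncomputable def rowNorm {d n : ℕ} (Z : Fin d → Matrix (Fin n) (Fin n) ℂ) : ℝ :=
  Real.sqrt (opNorm (∑ j, Z j * (Z j)ᴴ))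

/-- The column norm of a `d`-tuple of matrices: `‖Z₁ᴴZ₁ + ⋯ + Z_dᴴZ_d‖^{1/2}`. -/
noncomputable def colNorm {d n : ℕ} (Z : Fin d → Matrix (Fin n) (Fin n) ℂ) : ℝ :=
  Real.sqrt (opNorm (∑ j, (Z j)ᴴ * Z j))

/-- Two `d`-tuples are jointly similar if a single invertible matrix conjugates one
to the other componentwise. -/
def JointlySimilar {d n : ℕ} (Z W : Fin d → Matrix (Fin n) (Fin n) ℂ) : Prop :=
  ∃ S : Matrix (Fin n) (Fin n) ℂ, IsUnit S ∧ ∀ j, W j = S * Z j * S⁻¹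

/-- A `d`-tuple is irreducible if the only jointly invariant subspaces are `{0}` and `ℂⁿ`. -/
def IrreducibleTuple {d n : ℕ} (Z : Fin d → Matrix (Fin n) (Fin n) ℂ) : Prop :=
  ∀ W : Submodule ℂ (Fin n → ℂ), (∀ j, ∀ v ∈ W, (Z j).mulVec v ∈ W) → W = ⊥ ∨ W = ⊤

section
open scoped MatrixOrder Matrix.Norms.L2Operator

variable {d n : ℕ}


theorem opNorm_le_iff {M : Matrix (Fin n) (Fin n) ℂ} (hM : 0 ≤ M) {c : ℝ} (hc : 0 ≤ c) :
    opNorm M ≤ c ↔ M ≤ c • 1 := by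
  rw [← Algebra.algebraMap_eq_smul_one]
  exact CStarAlgebra.norm_le_iff_le_algebraMap M hc hM

theorem opNorm_lt_one {M : Matrix (Fin n) (Fin n) ℂ} (hM : 0 ≤ M) (h : (1 - M).PosDef) :
    opNorm M < 1 := by
  rcases subsingleton_or_nontrivial (Matrix (Fin n) (Fin n) ℂ) with hs | hn
  · rw [Subsingleton.elim M 0]
    simp [opNorm]
  · refine lt_of_le_of_ne ((opNorm_le_iff hM zero_le_one).2 ?_) fun h1 => ?_
    · rw [one_smul]
      exact h.posSemidef
    · have := CStarAlgebra.norm_mem_spectrum_of_nonneg hM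
      rw [show ‖M‖ = 1 from h1, spectrum.mem_iff, map_one] at this
      exact this h.isUnit

theorem le_trace_smul_one {M : Matrix (Fin n) (Fin n) ℂ} (hM : 0 ≤ M) :
    M ≤ M.trace.re • 1 := by
  have hP := Matrix.nonneg_iff_posSemidef.1 hM
  rw [← Algebra.algebraMap_eq_smul_one]
  refine le_algebraMap_of_spectrum_le (fun x hx => ?_) hP.isHermitian
  rw [hP.isHermitian.spectrum_real_eq_range_eigenvalues] at hx
  obtain ⟨i, rfl⟩ := hx
  rw [hP.isHermitian.trace_eq_sum_eigenvalues]
  simpa using Finset.single_le_sum (fun j _ => hP.eigenvalues_nonneg j) (Finset.mem_univ i)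

/-- The completely positive map `X ↦ ∑ j, Z j * X * (Z j)ᴴ` -/
def cpMap (Z : Fin d → Matrix (Fin n) (Fin n) ℂ) :
    Matrix (Fin n) (Fin n) ℂ →ₗ[ℂ] Matrix (Fin n) (Fin n) ℂ :=
  ∑ j, LinearMap.mulLeftRight ℂ (Z j, (Z j)ᴴ)

theorem cpMap_apply (Z : Fin d → Matrix (Fin n) (Fin n) ℂ) (X : Matrix (Fin n) (Fin n) ℂ) :
    cpMap Z X = ∑ j, Z j * X * (Z j)ᴴ := by
  simp [cpMap, LinearMap.sum_apply]

theorem cpMap_nonneg (Z : Fin d → Matrix (Fin n) (Fin n) ℂ) {X : Matrix (Fin n) (Fin n) ℂ}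
    (hX : 0 ≤ X) : 0 ≤ cpMap Z X := by
  rw [cpMap_apply]
  exact Finset.sum_nonneg fun j _ =>
    ((Matrix.nonneg_iff_posSemidef.1 hX).mul_mul_conjTranspose_same (Z j)).nonneg

theorem cpMap_mono (Z : Fin d → Matrix (Fin n) (Fin n) ℂ) : Monotone (cpMap Z) := fun X Y h => by
  rw [← sub_nonneg, ← map_sub]
  exact cpMap_nonneg Z (sub_nonneg.2 h)

theorem cpMap_iterate_nonneg (Z : Fin d → Matrix (Fin n) (Fin n) ℂ) (k : ℕ) :
    0 ≤ (cpMap Z ^ k) 1 := by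
  induction k with
  | zero => exact zero_le_one
  | succ k ih =>
    rw [pow_succ', Module.End.mul_apply]
    exact cpMap_nonneg Z ih

theorem cpMap_iterate_le (Z : Fin d → Matrix (Fin n) (Fin n) ℂ) {c : ℝ} (hc : 0 ≤ c)
    (h : cpMap Z 1 ≤ c • 1) (k : ℕ) : (cpMap Z ^ k) 1 ≤ c ^ k • 1 := by
  induction k with
  | zero => simp
  | succ k ih =>
    rw [pow_succ', Module.End.mul_apply]
    refine (cpMap_mono Z ih).trans ?_
    rw [LinearMap.map_smul_of_tower, pow_succ, mul_smul]
    exact smul_le_smul_of_nonneg_left h (pow_nonneg hc k)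

theorem trace_cpMap_mul (Z : Fin d → Matrix (Fin n) (Fin n) ℂ)
    (X Y : Matrix (Fin n) (Fin n) ℂ) :
    (cpMap (fun j => (Z j)ᴴ) X * Y).trace = (X * cpMap Z Y).trace := by
  simp only [cpMap_apply, Matrix.sum_mul, Matrix.mul_sum, Matrix.trace_sum,
    Matrix.conjTranspose_conjTranspose]
  refine Finset.sum_congr rfl fun j _ => ?_
  rw [Matrix.mul_assoc, Matrix.mul_assoc, Matrix.trace_mul_comm, Matrix.mul_assoc]

theorem trace_cpMap_iterate_mul (Z : Fin d → Matrix (Fin n) (Fin n) ℂ) (k : ℕ)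
    (X Y : Matrix (Fin n) (Fin n) ℂ) :
    ((cpMap (fun j => (Z j)ᴴ) ^ k) X * Y).trace = (X * (cpMap Z ^ k) Y).trace := by
  induction k generalizing Y with
  | zero => simp
  | succ k ih =>
    rw [pow_succ', Module.End.mul_apply, trace_cpMap_mul, ih, pow_succ, Module.End.mul_apply]

/-- If `∑ Z Zᴴ ≤ c` then for every `t > c` the adjoint map has a positive definite
`t`-subinvariant matrix, namely a partial Neumann series. -/
theorem exists_posDef_adjoint_le (Z : Fin d → Matrix (Fin n) (Fin n) ℂ) {c t : ℝ} (hc : 0 ≤ c)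
    (h : cpMap Z 1 ≤ c • 1) (ht : c < t) :
    ∃ P : Matrix (Fin n) (Fin n) ℂ, P.PosDef ∧ cpMap (fun j => (Z j)ᴴ) P ≤ t • P := by
  have ht0 : 0 < t := hc.trans_lt ht
  set Ψ := cpMap (fun j => (Z j)ᴴ)
  obtain ⟨N, hN⟩ : ∃ N : ℕ, (c / t) ^ (N + 1) * n ≤ 1 := by
    have h0 : Filter.Tendsto (fun N : ℕ => (c / t) ^ (N + 1) * n) Filter.atTop (nhds (0 * n)) :=
      (((tendsto_pow_atTop_nhds_zero_of_lt_one (div_nonneg hc ht0.le)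
        ((div_lt_one ht0).2 ht)).comp (Filter.tendsto_add_atTop_nat 1)).mul_const _)
    rw [zero_mul] at h0
    exact (h0.eventually_le_const zero_lt_one).exists
  set f : ℕ → Matrix (Fin n) (Fin n) ℂ := fun k => (t⁻¹ ^ k) • (Ψ ^ k) 1 with hf
  have hf0 : f 0 = 1 := by simp [hf]
  have hfn : ∀ k, 0 ≤ f k := fun k =>
    smul_nonneg (pow_nonneg (inv_nonneg.2 ht0.le) k) (cpMap_iterate_nonneg _ k)
  have hfs : ∀ k, Ψ (f k) = t • f (k + 1) := fun k => by
    simp only [hf]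
    rw [LinearMap.map_smul_of_tower, smul_smul, pow_succ' Ψ, Module.End.mul_apply, pow_succ' t⁻¹,
      ← mul_assoc, mul_inv_cancel₀ ht0.ne', one_mul]
  have hlast : f (N + 1) ≤ f 0 := by
    have htr : ((Ψ ^ (N + 1)) 1).trace.re ≤ c ^ (N + 1) * n := by
      have h1 := trace_cpMap_iterate_mul Z (N + 1) 1 1
      rw [mul_one, one_mul] at h1
      have h2 := (Matrix.le_iff.1 (cpMap_iterate_le Z hc h (N + 1))).trace_nonneg
      rw [Matrix.trace_sub, ← h1, Matrix.trace_smul, Matrix.trace_one, sub_nonneg] at h2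
      simpa [← Complex.ofReal_pow] using (Complex.le_def.1 h2).1
    have h3 := (le_trace_smul_one (cpMap_iterate_nonneg (fun j => (Z j)ᴴ) (N + 1))).trans
      (smul_le_smul_of_nonneg_right htr zero_le_one)
    rw [hf0]
    refine (smul_le_smul_of_nonneg_left h3 (pow_nonneg (inv_nonneg.2 ht0.le) (N + 1))).trans ?_
    rw [smul_smul]
    calc _ ≤ (1 : ℝ) • (1 : Matrix (Fin n) (Fin n) ℂ) := by
          refine smul_le_smul_of_nonneg_right ?_ zero_le_one
          rwa [← mul_assoc, ← mul_pow, inv_mul_eq_div]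
      _ = 1 := one_smul _ _
  refine ⟨∑ k ∈ Finset.range (N + 1), f k, ?_, ?_⟩
  · rw [Finset.sum_range_succ', hf0]
    exact Matrix.PosDef.posSemidef_add
      (Matrix.nonneg_iff_posSemidef.1 (Finset.sum_nonneg fun k _ => hfn _)) Matrix.PosDef.one
  · rw [map_sum, Finset.sum_congr rfl fun k _ => hfs k, ← Finset.smul_sum]
    refine smul_le_smul_of_nonneg_left ?_ ht0.le
    rw [Finset.sum_range_succ, Finset.sum_range_succ' f]
    gcongr

/-- Compactness: subinvariant matrices persist in the limit. -/
theorem exists_nonneg_adjoint_le [NeZero n] (Z : Fin d → Matrix (Fin n) (Fin n) ℂ) {c : ℝ}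
    (hc : 0 ≤ c) (h : cpMap Z 1 ≤ c • 1) :
    ∃ P : Matrix (Fin n) (Fin n) ℂ, 0 ≤ P ∧ P ≠ 0 ∧ cpMap (fun j => (Z j)ᴴ) P ≤ c • P := by
  have hex : ∀ k : ℕ, ∃ P : Matrix (Fin n) (Fin n) ℂ, 0 ≤ P ∧ P ∈ Metric.sphere 0 1 ∧
      cpMap (fun j => (Z j)ᴴ) P ≤ (c + 1 / ((k : ℝ) + 1)) • P := fun k => by
    obtain ⟨P, hP, hle⟩ := exists_posDef_adjoint_le Z hc h
      (lt_add_of_pos_right c (Nat.one_div_pos_of_nat (α := ℝ) (n := k)))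
    have hP0 : P ≠ 0 := hP.isUnit.ne_zero
    refine ⟨‖P‖⁻¹ • P, smul_nonneg (by positivity) hP.posSemidef.nonneg, ?_, ?_⟩
    · rw [mem_sphere_zero_iff_norm, norm_smul, norm_inv, norm_norm,
        inv_mul_cancel₀ (norm_ne_zero_iff.2 hP0)]
    · rw [LinearMap.map_smul_of_tower, smul_comm]
      exact smul_le_smul_of_nonneg_left hle (by positivity)
  choose P hP0 hPs hPle using hex
  have : ProperSpace (Matrix (Fin n) (Fin n) ℂ) := FiniteDimensional.proper ℂ _
  obtain ⟨Q, hQ, φ, hφ, hlim⟩ := (isCompact_sphere _ _).tendsto_subseq hPs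
  refine ⟨Q, ge_of_tendsto' hlim fun k => hP0 _, ?_, ?_⟩
  · rintro rfl
    simp at hQ
  · have hcont : Continuous (cpMap fun j => (Z j)ᴴ) := LinearMap.continuous_of_finiteDimensional _
    have hs := ((tendsto_one_div_add_atTop_nhds_zero_nat (𝕜 := ℝ)).comp
      hφ.tendsto_atTop).const_add c
    rw [add_zero] at hs
    exact le_of_tendsto_of_tendsto' ((hcont.tendsto Q).comp hlim) (hs.smul hlim)
      fun k => hPle (φ k)

theorem IrreducibleTuple.exists_posDef_adjoint_le {Z : Fin d → Matrix (Fin n) (Fin n) ℂ}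
    (hZ : IrreducibleTuple Z) {c : ℝ} (hc : 0 ≤ c) (h : cpMap Z 1 ≤ c • 1) :
    ∃ P : Matrix (Fin n) (Fin n) ℂ, P.PosDef ∧ cpMap (fun j => (Z j)ᴴ) P ≤ c • P := by
  rcases eq_or_ne n 0 with rfl | hn
  · exact ⟨1, Matrix.PosDef.one, (Subsingleton.elim _ _).le⟩
  have : NeZero n := ⟨hn⟩
  obtain ⟨P, hP, hP0, hle⟩ := exists_nonneg_adjoint_le Z hc h
  have hPs := Matrix.nonneg_iff_posSemidef.1 hP
  refine ⟨P, ?_, hle⟩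
  have hker : ∀ j, ∀ v ∈ LinearMap.ker P.mulVecLin, Z j *ᵥ v ∈ LinearMap.ker P.mulVecLin := by
    intro j v hv
    rw [LinearMap.mem_ker, Matrix.mulVecLin_apply] at hv ⊢
    have hq := (Matrix.le_iff.1 hle).dotProduct_mulVec_nonneg v
    have hterm : ∀ i, star v ⬝ᵥ ((Z i)ᴴ * P * Z i) *ᵥ v
        = star (Z i *ᵥ v) ⬝ᵥ P *ᵥ (Z i *ᵥ v) := fun i => by
      rw [Matrix.star_mulVec, ← Matrix.mulVec_mulVec, ← Matrix.mulVec_mulVec,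
        Matrix.dotProduct_mulVec _ (Z i)ᴴ]
    simp only [cpMap_apply, Matrix.conjTranspose_conjTranspose, Matrix.sub_mulVec,
      Matrix.smul_mulVec, hv, smul_zero, zero_sub, dotProduct_neg, Matrix.sum_mulVec,
      dotProduct_sum, hterm] at hq
    have hnn : ∀ i ∈ Finset.univ, 0 ≤ star (Z i *ᵥ v) ⬝ᵥ P *ᵥ (Z i *ᵥ v) :=
      fun i _ => hPs.dotProduct_mulVec_nonneg _
    have hz := (Finset.sum_eq_zero_iff_of_nonneg hnn).1
      (le_antisymm (neg_nonneg.1 hq) (Finset.sum_nonneg hnn)) j (Finset.mem_univ j)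
    exact (hPs.dotProduct_mulVec_zero_iff _).1 hz
  rcases hZ _ hker with hk | hk
  · rw [hPs.posDef_iff_isUnit, ← Matrix.mulVec_injective_iff_isUnit]
    exact LinearMap.ker_eq_bot.1 hk
  · refine absurd ?_ hP0
    rw [LinearMap.ker_eq_top] at hk
    exact Matrix.toLin'.injective (by rw [Matrix.toLin'_apply', hk, map_zero])

theorem IrreducibleTuple.conjTranspose {Z : Fin d → Matrix (Fin n) (Fin n) ℂ}
    (hZ : IrreducibleTuple Z) : IrreducibleTuple fun j => (Z j)ᴴ := by
  intro W hW
  let e := WithLp.linearEquiv 2 ℂ (Fin n → ℂ)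
  let U : Submodule ℂ (EuclideanSpace ℂ (Fin n)) := W.comap e.toLinearMap
  have hU : ∀ j, ∀ v ∈ (Uᗮ).map e.toLinearMap, Z j *ᵥ v ∈ (Uᗮ).map e.toLinearMap := by
    rintro j _ ⟨v, hv, rfl⟩
    refine ⟨e.symm (Z j *ᵥ e v), ?_, by simp⟩
    rw [SetLike.mem_coe, Submodule.mem_orthogonal] at hv ⊢
    intro u hu
    have := hv (e.symm ((Z j)ᴴ *ᵥ e u)) (by simpa [U] using hW j (e u) hu)
    rw [EuclideanSpace.inner_eq_star_dotProduct] at this ⊢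
    rw [← this]
    simp [e, Matrix.star_mulVec, dotProduct_comm _ (star u.ofLp), Matrix.dotProduct_mulVec,
      dotProduct_comm v.ofLp]
  rcases hZ _ hU with h | h
  · right
    rw [Submodule.map_eq_bot_iff, Submodule.orthogonal_eq_bot_iff] at h
    exact eq_top_iff.2 fun v _ => by
      simpa [U] using (h ▸ Submodule.mem_top : e.symm v ∈ U)
  · left
    rw [Submodule.map_eq_top_iff, Submodule.orthogonal_eq_top_iff] at h
    exact eq_bot_iff.2 fun v hv => by
      have hv' : e.symm v ∈ U := by simpa [U] using hv
      rw [h, Submodule.mem_bot, LinearEquiv.map_eq_zero_iff] at hv'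
      simpa using hv'

theorem exists_similar_of_posDef (Z : Fin d → Matrix (Fin n) (Fin n) ℂ) {t : ℝ}
    {P : Matrix (Fin n) (Fin n) ℂ} (hP : P.PosDef)
    (h : cpMap (fun j => (Z j)ᴴ) P ≤ t • P) :
    ∃ W : Fin d → Matrix (Fin n) (Fin n) ℂ, JointlySimilar Z W ∧ ∑ j, (W j)ᴴ * W j ≤ t • 1 := by
  obtain ⟨S, hS⟩ := CStarAlgebra.nonneg_iff_eq_star_mul_self.mp hP.posSemidef.nonneg
  rw [Matrix.star_eq_conjTranspose] at hS
  have hSu : IsUnit S := by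
    have hu := (Matrix.isUnit_iff_isUnit_det P).1 hP.isUnit
    rw [hS, Matrix.det_mul] at hu
    exact (Matrix.isUnit_iff_isUnit_det S).2 (isUnit_of_mul_isUnit_right hu)
  have hdet := (Matrix.isUnit_iff_isUnit_det S).1 hSu
  refine ⟨fun j => S * Z j * S⁻¹, ⟨S, hSu, fun _ => rfl⟩, ?_⟩
  have h1 : S⁻¹ᴴ * Sᴴ = 1 := by
    rw [← Matrix.conjTranspose_mul, Matrix.mul_nonsing_inv _ hdet, Matrix.conjTranspose_one]
  have hid : S⁻¹ᴴ * P * S⁻¹ = 1 := by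
    rw [hS, ← Matrix.mul_assoc, h1, Matrix.one_mul, Matrix.mul_nonsing_inv _ hdet]
  have hsum : ∑ j, (S * Z j * S⁻¹)ᴴ * (S * Z j * S⁻¹)
      = S⁻¹ᴴ * cpMap (fun j => (Z j)ᴴ) P * S⁻¹ := by
    rw [cpMap_apply, Matrix.mul_sum, Matrix.sum_mul, hS]
    simp only [Matrix.conjTranspose_mul, Matrix.conjTranspose_conjTranspose, Matrix.mul_assoc]
  have hc := (Matrix.le_iff.1 h).conjTranspose_mul_mul_same S⁻¹
  rw [Matrix.mul_sub, Matrix.sub_mul, Matrix.mul_smul, Matrix.smul_mul, hid, ← hsum] at hc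
  exact Matrix.le_iff.2 hc

theorem cpMap_one (Z : Fin d → Matrix (Fin n) (Fin n) ℂ) :
    cpMap Z 1 = ∑ j, Z j * (Z j)ᴴ := by
  simp [cpMap_apply]

theorem cpMap_one_le_rowNorm (Z : Fin d → Matrix (Fin n) (Fin n) ℂ) :
    cpMap Z 1 ≤ rowNorm Z ^ 2 • 1 := by
  rw [← opNorm_le_iff (cpMap_nonneg Z zero_le_one) (sq_nonneg _), rowNorm,
    cpMap_one]
  exact (Real.sq_sqrt (norm_nonneg _)).ge

theorem colNorm_le {W : Fin d → Matrix (Fin n) (Fin n) ℂ} {r : ℝ} (hr : 0 ≤ r)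
    (h : ∑ j, (W j)ᴴ * W j ≤ r ^ 2 • 1) : colNorm W ≤ r := by
  have h0 : 0 ≤ ∑ j, (W j)ᴴ * W j :=
    Finset.sum_nonneg fun j _ => (Matrix.posSemidef_conjTranspose_mul_self (W j)).nonneg
  exact Real.sqrt_le_iff.2 ⟨hr, (opNorm_le_iff h0 (sq_nonneg r)).2 h⟩

theorem exists_similar_colNorm_le (Z : Fin d → Matrix (Fin n) (Fin n) ℂ) {ε : ℝ} (hε : 0 < ε) :
    ∃ W : Fin d → Matrix (Fin n) (Fin n) ℂ, JointlySimilar Z W ∧ colNorm W ≤ rowNorm Z + ε := by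
  have hr : 0 ≤ rowNorm Z := Real.sqrt_nonneg _
  obtain ⟨P, hP, hle⟩ := exists_posDef_adjoint_le Z (sq_nonneg _) (cpMap_one_le_rowNorm Z)
    (pow_lt_pow_left₀ (lt_add_of_pos_right (rowNorm Z) hε) hr two_ne_zero)
  obtain ⟨W, hW, hWle⟩ := exists_similar_of_posDef Z hP hle
  exact ⟨W, hW, colNorm_le (by positivity) hWle⟩

theorem IrreducibleTuple.exists_similar_colNorm_le {Z : Fin d → Matrix (Fin n) (Fin n) ℂ}
    (hZ : IrreducibleTuple Z) :
    ∃ W : Fin d → Matrix (Fin n) (Fin n) ℂ, JointlySimilar Z W ∧ colNorm W ≤ rowNorm Z := by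
  obtain ⟨P, hP, hle⟩ := hZ.exists_posDef_adjoint_le (sq_nonneg _) (cpMap_one_le_rowNorm Z)
  obtain ⟨W, hW, hWle⟩ := exists_similar_of_posDef Z hP hle
  exact ⟨W, hW, colNorm_le (Real.sqrt_nonneg _) hWle⟩

theorem exists_similar_strict_column_contraction {Z : Fin d → Matrix (Fin n) (Fin n) ℂ}
    (hZ : (1 - ∑ j, Z j * (Z j)ᴴ).PosDef) :
    ∃ W : Fin d → Matrix (Fin n) (Fin n) ℂ,
      JointlySimilar Z W ∧ (1 - ∑ j, (W j)ᴴ * W j).PosDef := by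
  rw [← cpMap_one] at hZ
  have h0 := cpMap_nonneg Z zero_le_one
  have hc : 0 ≤ opNorm (cpMap Z 1) := norm_nonneg _
  obtain ⟨t, hct, ht⟩ := exists_between (opNorm_lt_one h0 hZ)
  obtain ⟨P, hP, hle⟩ := exists_posDef_adjoint_le Z hc ((opNorm_le_iff h0 hc).1 le_rfl) hct
  obtain ⟨W, hW, hWle⟩ := exists_similar_of_posDef Z hP hle
  refine ⟨W, hW, ?_⟩
  have hadd := (Matrix.PosDef.one.smul (sub_pos.2 ht)).add_posSemidef (Matrix.le_iff.1 hWle)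
  rwa [sub_smul, one_smul, sub_add_sub_cancel] at hadd

theorem JointlySimilar.of_conjTranspose {Z W : Fin d → Matrix (Fin n) (Fin n) ℂ}
    (h : JointlySimilar (fun j => (Z j)ᴴ) W) : JointlySimilar Z fun j => (W j)ᴴ := by
  obtain ⟨S, hS, hW⟩ := h
  have hdet := (Matrix.isUnit_iff_isUnit_det S).1 hS
  refine ⟨S⁻¹ᴴ, ((Matrix.isUnit_nonsing_inv_iff).2 hS).star, fun j => ?_⟩
  simp only [hW]
  rw [Matrix.conjTranspose_nonsing_inv, Matrix.nonsing_inv_nonsing_inv _ (by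
    rw [Matrix.det_conjTranspose]
    exact hdet.star)]
  simp [Matrix.mul_assoc, Matrix.conjTranspose_nonsing_inv]

end

theorem stmt0 (d n : ℕ) (Z : Fin d → Matrix (Fin n) (Fin n) ℂ) :
    (∀ ε : ℝ, 0 < ε →
      ∃ W : Fin d → Matrix (Fin n) (Fin n) ℂ,
        JointlySimilar Z W ∧ colNorm W ≤ rowNorm Z + ε) ∧
    (∀ ε : ℝ, 0 < ε →
      ∃ W' : Fin d → Matrix (Fin n) (Fin n) ℂ,
        JointlySimilar Z W' ∧ rowNorm W' ≤ colNorm Z + ε) ∧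
    (IrreducibleTuple Z →
      (∃ W : Fin d → Matrix (Fin n) (Fin n) ℂ,
        JointlySimilar Z W ∧ colNorm W ≤ rowNorm Z) ∧
      (∃ W' : Fin d → Matrix (Fin n) (Fin n) ℂ,
        JointlySimilar Z W' ∧ rowNorm W' ≤ colNorm Z)) ∧
    ((1 - ∑ j, Z j * (Z j)ᴴ).PosDef →
      ∃ W : Fin d → Matrix (Fin n) (Fin n) ℂ,
        JointlySimilar Z W ∧ (1 - ∑ j, (W j)ᴴ * W j).PosDef) ∧
    ((1 - ∑ j, (Z j)ᴴ * Z j).PosDef →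
      ∃ W : Fin d → Matrix (Fin n) (Fin n) ℂ,
        JointlySimilar Z W ∧ (1 - ∑ j, W j * (W j)ᴴ).PosDef) := by
  have hcol : ∀ W : Fin d → Matrix (Fin n) (Fin n) ℂ,
      rowNorm (fun j => (W j)ᴴ) = colNorm W := fun W => by simp [rowNorm, colNorm]
  refine ⟨fun ε hε => exists_similar_colNorm_le Z hε, fun ε hε => ?_,
    fun hZ => ⟨hZ.exists_similar_colNorm_le, ?_⟩,
    exists_similar_strict_column_contraction, fun hZ => ?_⟩
  · obtain ⟨W, hW, hle⟩ := exists_similar_colNorm_le (fun j => (Z j)ᴴ) hε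
    exact ⟨_, hW.of_conjTranspose, by rwa [hcol, ← hcol Z]⟩
  · obtain ⟨W, hW, hle⟩ := hZ.conjTranspose.exists_similar_colNorm_le
    exact ⟨_, hW.of_conjTranspose, by rwa [hcol, ← hcol Z]⟩
  · obtain ⟨W, hW, hpos⟩ := exists_similar_strict_column_contraction
      (Z := fun j => (Z j)ᴴ) (by simpa using hZ)
    exact ⟨_, hW.of_conjTranspose, by simpa using hpos⟩
end

section
/- Let (A, B, C, D) be a Fornasini–Marchesini realization consisting of a d-tuple A = (A_1,…,A_d) of m×m complex matrices, column vectors B_1,…,B_d ∈ ℂ^{m×1}, a row covector C ∈ ℂ^{1×m}, and D ∈ ℂ. Let λ ∈ ℂ \ {0} and let Z = (Z_1,…,Z_d) be a d-tuple of n×n complex matrices such that L_A(Z) is invertible. Set A^{(λ)}_j := A_j + λ^{-1} B_j C and r(Z) := D·I_n + (I_n ⊗ C) L_A(Z)^{-1} (Σ_j Z_j ⊗ B_j) ∈ ℂ^{n×n}. Then λ^n · det L_{A^{(λ)}}(Z) = det L_A(Z) · det((λ + D) I_n − r(Z)). In particular, λ + D is an eigenvalue of r(Z) if and only if L_{A^{(λ)}}(Z)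 is singular. -/
open Matrix Kronecker

/-- The monic linear pencil `L_A(Z) = 1 − Σⱼ Zⱼ ⊗ Aⱼ` (Kronecker products). -/
noncomputable def pencil {d m n : ℕ} (A : Fin d → Matrix (Fin m) (Fin m) ℂ)
    (Z : Fin d → Matrix (Fin n) (Fin n) ℂ) : Matrix (Fin n × Fin m) (Fin n × Fin m) ℂ :=
  1 - ∑ j, Z j ⊗ₖ A j

/-- The transfer function of the Fornasini–Marchesini realization `(A, B, C, D)`
evaluated at the tuple `Z`: `r(Z) = D·Iₙ + (Iₙ ⊗ C) L_A(Z)⁻¹ (Σⱼ Zⱼ ⊗ Bⱼ)`,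
reindexed to an `n × n` matrix via `Fin n × Fin 1 ≃ Fin n`. -/
noncomputable def transfer {d m n : ℕ} (A : Fin d → Matrix (Fin m) (Fin m) ℂ)
    (B : Fin d → Matrix (Fin m) (Fin 1) ℂ) (C : Matrix (Fin 1) (Fin m) ℂ) (D : ℂ)
    (Z : Fin d → Matrix (Fin n) (Fin n) ℂ) : Matrix (Fin n) (Fin n) ℂ :=
  D • 1 +
    (Matrix.reindex (Equiv.prodUnique (Fin n) (Fin 1)) (Equiv.prodUnique (Fin n) (Fin 1)))
      (((1 : Matrix (Fin n) (Fin n) ℂ) ⊗ₖ C) * (pencil A Z)⁻¹ * (∑ j, Z j ⊗ₖ B j))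

/-- Perturbing the coefficients of a pencil by `c • Bⱼ C` subtracts a product of rank at most `n`. -/
theorem pencil_add_smul_mul {d m n : ℕ} (A : Fin d → Matrix (Fin m) (Fin m) ℂ)
    (B : Fin d → Matrix (Fin m) (Fin 1) ℂ) (C : Matrix (Fin 1) (Fin m) ℂ) (c : ℂ)
    (Z : Fin d → Matrix (Fin n) (Fin n) ℂ) :
    pencil (fun j => A j + c • (B j * C)) Z =
      pencil A Z + (-c • ∑ j, Z j ⊗ₖ B j) * ((1 : Matrix (Fin n) (Fin n) ℂ) ⊗ₖ C) := by
  have hterm (j : Fin d) : Z j ⊗ₖ (A j + c • (B j * C)) =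
      Z j ⊗ₖ A j + c • ((Z j ⊗ₖ B j) * ((1 : Matrix (Fin n) (Fin n) ℂ) ⊗ₖ C)) := by
    rw [← mul_kronecker_mul, Matrix.mul_one, kronecker_add, kronecker_smul]
  simp only [pencil, hterm, Finset.sum_add_distrib, ← Finset.smul_sum, ← Matrix.sum_mul,
    Matrix.smul_mul, neg_smul, Matrix.neg_mul]
  abel

/-- Determinant identity relating the perturbed pencil to the transfer function. -/
theorem pow_mul_det_pencil_add_smul_mul {d m n : ℕ} (A : Fin d → Matrix (Fin m) (Fin m) ℂ)
    (B : Fin d → Matrix (Fin m) (Fin 1) ℂ) (C : Matrix (Fin 1) (Fin m) ℂ) (D : ℂ)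
    {lam : ℂ} (hlam : lam ≠ 0)
    (Z : Fin d → Matrix (Fin n) (Fin n) ℂ) (hL : IsUnit (pencil A Z)) :
    lam ^ n * (pencil (fun j => A j + lam⁻¹ • (B j * C)) Z).det =
      (pencil A Z).det *
        ((lam + D) • (1 : Matrix (Fin n) (Fin n) ℂ) - transfer A B C D Z).det := by
  rw [pencil_add_smul_mul, det_add_mul _ _ ((isUnit_iff_isUnit_det _).mp hL), mul_left_comm]
  congr 1
  set W := ((1 : Matrix (Fin n) (Fin n) ℂ) ⊗ₖ C) * (pencil A Z)⁻¹ * (∑ j, Z j ⊗ₖ B j) with hW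
  have htransfer : (lam + D) • (1 : Matrix (Fin n) (Fin n) ℂ) - transfer A B C D Z =
      Matrix.reindex (Equiv.prodUnique (Fin n) (Fin 1)) (Equiv.prodUnique (Fin n) (Fin 1))
        (lam • (1 + -lam⁻¹ • W)) := by
    rw [transfer, ← hW, smul_add, smul_smul, mul_neg, mul_inv_cancel₀ hlam]
    simp only [reindex_apply, submatrix_add, submatrix_smul, Pi.add_apply, Pi.smul_apply,
      submatrix_one_equiv, submatrix_neg, Pi.neg_apply, neg_smul, one_smul, add_smul]
    abel
  rw [htransfer, det_reindex_self, det_smul, Matrix.mul_smul, ← hW]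
  simp

/-- A scalar is an eigenvalue of a square matrix iff the characteristic matrix has zero
determinant. -/
theorem exists_mulVec_eq_smul_iff_det_eq_zero {n K : Type*} [Fintype n] [DecidableEq n] [Field K]
    (M : Matrix n n K) (c : K) :
    (∃ v : n → K, v ≠ 0 ∧ M.mulVec v = c • v) ↔ (c • (1 : Matrix n n K) - M).det = 0 := by
  rw [← exists_mulVec_eq_zero_iff]
  simp only [sub_mulVec, smul_mulVec, one_mulVec, sub_eq_zero, eq_comm]

theorem stmt2 (d m n : ℕ) (A : Fin d → Matrix (Fin m) (Fin m) ℂ)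
    (B : Fin d → Matrix (Fin m) (Fin 1) ℂ) (C : Matrix (Fin 1) (Fin m) ℂ) (D : ℂ)
    (lam : ℂ) (hlam : lam ≠ 0)
    (Z : Fin d → Matrix (Fin n) (Fin n) ℂ) (hL : IsUnit (pencil A Z)) :
    lam ^ n * (pencil (fun j => A j + lam⁻¹ • (B j * C)) Z).det =
      (pencil A Z).det *
        ((lam + D) • (1 : Matrix (Fin n) (Fin n) ℂ) - transfer A B C D Z).det ∧
    ((∃ v : Fin n → ℂ, v ≠ 0 ∧ (transfer A B C D Z).mulVec v = (lam + D) • v) ↔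
      ¬ IsUnit (pencil (fun j => A j + lam⁻¹ • (B j * C)) Z)) := by
  have hdet := pow_mul_det_pencil_add_smul_mul A B C D hlam Z hL
  refine ⟨hdet, ?_⟩
  have hA : (pencil A Z).det ≠ 0 := ((isUnit_iff_isUnit_det _).mp hL).ne_zero
  rw [exists_mulVec_eq_smul_iff_det_eq_zero, isUnit_iff_isUnit_det, isUnit_iff_ne_zero, not_not]
  constructor <;> intro h <;> simpa [h, hA, hlam] using hdet
end

section
/- Let U = (U_1,…,U_d) be a row isometry on a complex Hilbert space K which is Cuntz (Σ_j U_j U_j* = I_K), let U' = (U'_1,…,U'_d) be a row isometry on a complex Hilbert space K', and let X : K → K' be a bounded linear operator with X U_j = U'_j X for all j = 1,…,d. Then X* U'_j = U_j X* for all j; consequently X*X commutes with every U_j and U_j*, and XX* commutes with every U'_j and U'_j*. -/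
open ContinuousLinearMap

/-- A `d`-tuple of operators is a row isometry if `Uᵢ* Uⱼ = δᵢⱼ I`. -/
def IsRowIsometry {d : ℕ} {K : Type*} [NormedAddCommGroup K] [InnerProductSpace ℂ K]
    [CompleteSpace K] (U : Fin d → K →L[ℂ] K) : Prop :=
  ∀ i j, (adjoint (U i)).comp (U j) = if i = j then 1 else 0

theorem stmt8 {K K' : Type*}
    [NormedAddCommGroup K] [InnerProductSpace ℂ K] [CompleteSpace K]
    [NormedAddCommGroup K'] [InnerProductSpace ℂ K'] [CompleteSpace K']
    (d : ℕ) (U : Fin d → K →L[ℂ] K) (U' : Fin d → K' →L[ℂ] K')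
    (hU : IsRowIsometry U)
    (hUCuntz : ∑ j, (U j).comp (adjoint (U j)) = 1)
    (hU' : IsRowIsometry U')
    (X : K →L[ℂ] K') (hX : ∀ j, X.comp (U j) = (U' j).comp X) :
    (∀ j, (adjoint X).comp (U' j) = (U j).comp (adjoint X)) ∧
    (∀ j, Commute ((adjoint X).comp X) (U j) ∧
      Commute ((adjoint X).comp X) (adjoint (U j))) ∧
    (∀ j, Commute (X.comp (adjoint X)) (U' j) ∧
      Commute (X.comp (adjoint X)) (adjoint (U' j))) := by
  have hX_adj (k : Fin d) : (adjoint (U k)).comp (adjoint X) =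
      (adjoint X).comp (adjoint (U' k)) := by
    rw [← adjoint_comp, hX k, adjoint_comp]
  have h (j : Fin d) : (adjoint X).comp (U' j) = (U j).comp (adjoint X) := by
    calc (adjoint X).comp (U' j)
        = (∑ k, (U k).comp (adjoint (U k))).comp ((adjoint X).comp (U' j)) := by
          rw [hUCuntz]; rfl
      _ = ∑ k, (U k).comp ((adjoint X).comp ((adjoint (U' k)).comp (U' j))) := by
          rw [finsetSum_comp]
          refine Finset.sum_congr rfl fun k _ => ?_
          rw [← comp_assoc (adjoint X), ← hX_adj]
          rfl
      _ = (U j).comp (adjoint X) := by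
          rw [Finset.sum_eq_single j]
          · rw [hU' j j, if_pos rfl]; rfl
          · intro k _ hk
            rw [hU' k j, if_neg hk, comp_zero, comp_zero]
          · simp
  have h_adj (j : Fin d) : (adjoint (U' j)).comp X = X.comp (adjoint (U j)) := by
    simpa only [adjoint_comp, adjoint_adjoint] using congrArg adjoint (h j)
  refine ⟨h, fun j => ⟨?_, ?_⟩, fun j => ⟨?_, ?_⟩⟩
  · change ((adjoint X).comp X).comp (U j) = (U j).comp ((adjoint X).comp X)
    rw [comp_assoc, hX, ← comp_assoc, h, comp_assoc]
  · change ((adjoint X).comp X).comp (adjoint (U j)) =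
      (adjoint (U j)).comp ((adjoint X).comp X)
    rw [comp_assoc, ← h_adj, ← comp_assoc, ← hX_adj, comp_assoc]
  · change (X.comp (adjoint X)).comp (U' j) = (U' j).comp (X.comp (adjoint X))
    rw [comp_assoc, h, ← comp_assoc, hX, comp_assoc]
  · change (X.comp (adjoint X)).comp (adjoint (U' j)) =
      (adjoint (U' j)).comp (X.comp (adjoint X))
    rw [comp_assoc, ← hX_adj, ← comp_assoc, ← h_adj, comp_assoc]
end

section
/- Let n ≥ 1 and let F be an analytic function from an open disk D(0,R) ⊆ ℂ (with R > 0) into the n×n complex matrices such that F(λ) is invertible for every λ ∈ D(0,R). Write the power series expansions F(λ) = Σ_{j≥0} λ^j F_j and F(λ)^{-1} = Σ_{k≥0} λ^k G_k, converging on D(0,R). Then det F(λ) = 1 for all λ ∈ D(0,R) if and only if det F_0 = 1 and, for every ℓ ≥ 1, Σ_{j=1}^{ℓ} j · tr(F_j G_{ℓ−j}) = 0. -/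
open Matrix

namespace Derivation

variable {k A : Type*} [CommRing k] [CommRing A] [Algebra k A] (D : Derivation k A A)

/-- Leibniz rule for a finite product. -/
theorem map_prod_eq_sum_update {ι : Type*} [DecidableEq ι] (s : Finset ι) (f : ι → A) :
    D (∏ i ∈ s, f i) = ∑ i ∈ s, ∏ j ∈ s, Function.update f i (D (f i)) j := by
  induction s using Finset.induction_on with
  | empty => simp
  | insert a s ha ih =>
    rw [Finset.prod_insert ha, D.leibniz, ih, Finset.sum_insert ha, Finset.prod_insert ha,
      Finset.prod_update_of_notMem ha, Function.update_self, smul_eq_mul, smul_eq_mul,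
      Finset.mul_sum, mul_comm (∏ i ∈ s, f i), add_comm]
    congr 1
    refine Finset.sum_congr rfl fun i hi => ?_
    rw [Finset.prod_insert ha, Function.update_of_ne (ne_of_mem_of_not_mem hi ha).symm]

/-- Jacobi's formula for an arbitrary derivation. -/
theorem map_det {n : Type*} [Fintype n] [DecidableEq n] (M : Matrix n n A) :
    D M.det = (M.adjugate * M.map D).trace := by
  have hcol (i : n) : (M.adjugate * M.map D) i i = (M.updateCol i fun j => D (M j i)).det := by
    rw [← cramer_apply, cramer_eq_adjugate_mulVec]
    rfl
  simp only [trace, diag_apply, hcol, det_apply, map_sum, Units.smul_def, map_zsmul,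
    map_prod_eq_sum_update, Finset.smul_sum]
  rw [Finset.sum_comm]
  refine Finset.sum_congr rfl fun i _ => Finset.sum_congr rfl fun σ _ => ?_
  congr 1
  refine Finset.prod_congr rfl fun j _ => ?_
  rcases eq_or_ne j i with rfl | hj
  · simp
  · simp [hj]

end Derivation

namespace PowerSeries

/-- The power series `p` converges at `z` with sum `s`. -/
def HasSumAt (p : PowerSeries ℂ) (z s : ℂ) : Prop :=
  HasSum (fun k => z ^ k * coeff k p) s

variable {p q : PowerSeries ℂ} {z s t : ℂ}

theorem hasSumAt_one (z : ℂ) : HasSumAt 1 z 1 := by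
  unfold HasSumAt
  convert hasSum_single (f := fun k => z ^ k * coeff k (1 : PowerSeries ℂ)) 0 ?_ using 1
  · simp
  · intro k hk
    simp [coeff_one, hk]

theorem hasSumAt_zero (z : ℂ) : HasSumAt 0 z 0 := by
  simp [HasSumAt, hasSum_zero]

theorem HasSumAt.zsmul (hp : HasSumAt p z s) (m : ℤ) : HasSumAt (m • p) z (m • s) := by
  simpa only [HasSumAt, map_zsmul, mul_smul_comm] using HasSum.const_smul m hp

theorem HasSumAt.sum {ι : Type*} {S : Finset ι} {p : ι → PowerSeries ℂ} {s : ι → ℂ}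
    (h : ∀ i ∈ S, HasSumAt (p i) z (s i)) : HasSumAt (∑ i ∈ S, p i) z (∑ i ∈ S, s i) := by
  simpa [HasSumAt, Finset.mul_sum] using hasSum_sum h

theorem HasSumAt.mul (hp : HasSumAt p z s) (hq : HasSumAt q z t) :
    HasSumAt (p * q) z (s * t) := by
  have h := (summable_norm_sum_mul_antidiagonal_of_summable_norm
    hp.summable.norm hq.summable.norm).of_norm.hasSum
  rw [← tsum_mul_tsum_eq_tsum_sum_antidiagonal_of_summable_norm
    hp.summable.norm hq.summable.norm, hp.tsum_eq, hq.tsum_eq] at h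
  refine h.congr_fun fun k => ?_
  rw [coeff_mul, Finset.mul_sum]
  refine Finset.sum_congr rfl fun x hx => ?_
  rw [← Finset.HasAntidiagonal.mem_antidiagonal.1 hx, pow_add]
  ring

theorem HasSumAt.prod {ι : Type*} (S : Finset ι) {p : ι → PowerSeries ℂ} {s : ι → ℂ}
    (h : ∀ i, HasSumAt (p i) z (s i)) : HasSumAt (∏ i ∈ S, p i) z (∏ i ∈ S, s i) := by
  classical
  induction S using Finset.induction_on with
  | empty => simpa using hasSumAt_one z
  | insert a S ha ih =>
    rw [Finset.prod_insert ha, Finset.prod_insert ha]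
    exact (h a).mul ih

theorem HasSumAt.det {n : Type*} [Fintype n] [DecidableEq n] {P : Matrix n n (PowerSeries ℂ)}
    {M : Matrix n n ℂ} (h : ∀ i j, HasSumAt (P i j) z (M i j)) : HasSumAt P.det z M.det := by
  simp only [det_apply, Units.smul_def]
  exact HasSumAt.sum fun σ _ => (HasSumAt.prod _ fun i => h (σ i) i).zsmul _

/-- A power series is determined by its sums on a disk. -/
theorem eq_of_hasSumAt {R : ℝ} (hR : 0 < R) {f : ℂ → ℂ}
    (hp : ∀ z, ‖z‖ < R → HasSumAt p z (f z)) (hq : ∀ z, ‖z‖ < R → HasSumAt q z (f z)) :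
    p = q := by
  have key (r : PowerSeries ℂ) (hr : ∀ z, ‖z‖ < R → HasSumAt r z (f z)) :
      HasFPowerSeriesAt f (FormalMultilinearSeries.ofScalars ℂ fun k => coeff k r) 0 := by
    rw [hasFPowerSeriesAt_iff]
    filter_upwards [Metric.ball_mem_nhds (0 : ℂ) hR] with z hz
    simpa [HasSumAt, FormalMultilinearSeries.coeff_ofScalars] using hr z (by simpa using hz)
  have h := (key p hp).eq_formalMultilinearSeries (key q hq)
  ext k
  simpa [FormalMultilinearSeries.coeff_ofScalars] using
    congrArg (fun φ => FormalMultilinearSeries.coeff φ k) h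

/-- The matrix of power series whose `k`-th coefficient matrix is `c k`. -/
def matrixMk {n : Type*} (c : ℕ → Matrix n n ℂ) : Matrix n n (PowerSeries ℂ) :=
  Matrix.of fun i j => mk fun k => c k i j

theorem hasSumAt_matrixMk {n : Type*} {c : ℕ → Matrix n n ℂ} {M : Matrix n n ℂ}
    (h : HasSum (fun k => z ^ k • c k) M) (i j : n) : HasSumAt (matrixMk c i j) z (M i j) := by
  simpa [HasSumAt, matrixMk] using Pi.hasSum.1 (Pi.hasSum.1 h i) j

theorem constantCoeff_det_matrixMk {n : Type*} [Fintype n] [DecidableEq n]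
    (c : ℕ → Matrix n n ℂ) : constantCoeff (matrixMk c).det = (c 0).det := by
  rw [RingHom.map_det]
  congr 1

theorem coeff_trace_derivative_mul {n : Type*} [Fintype n] (c d : ℕ → Matrix n n ℂ) (m : ℕ) :
    coeff m ((matrixMk c).map (derivative ℂ) * matrixMk d).trace =
      ∑ j ∈ Finset.Icc 1 (m + 1), (j : ℂ) * (c j * d (m + 1 - j)).trace := by
  have hIcc : Finset.Icc 1 (m + 1) = Finset.Ico 1 (m + 2) := rfl
  rw [hIcc, Finset.sum_Ico_eq_sum_range]
  simp only [trace, diag_apply, mul_apply, map_sum, coeff_mul,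
    Finset.Nat.sum_antidiagonal_eq_sum_range_succ_mk, Finset.mul_sum]
  conv_rhs => rw [Finset.sum_comm]
  refine Finset.sum_congr rfl fun i _ => ?_
  rw [Finset.sum_comm]
  refine Finset.sum_congr rfl fun a _ => Finset.sum_congr rfl fun k _ => ?_
  rw [show m + 1 - (1 + a) = m - a by omega, add_comm 1 a]
  simp [matrixMk, coeff_derivative]
  ring

/-- The determinant of an invertible matrix of power series is `1` iff its constant term is `1`
and its logarithmic derivative vanishes. -/
theorem det_eq_one_iff {n : Type*} [Fintype n] [DecidableEq n]
    {P Q : Matrix n n (PowerSeries ℂ)} (h : P * Q = 1) :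
    P.det = 1 ↔ constantCoeff P.det = 1 ∧ (P.map (derivative ℂ) * Q).trace = 0 := by
  have hadj : P.adjugate = P.det • Q := by
    rw [← mul_one P.adjugate, ← h, ← mul_assoc, adjugate_mul, smul_mul_assoc, one_mul]
  have hder : derivative ℂ P.det = P.det * (P.map (derivative ℂ) * Q).trace := by
    rw [Derivation.map_det, hadj, smul_mul_assoc, trace_smul, smul_eq_mul, trace_mul_comm]
  constructor
  · intro h1
    rw [h1, one_mul] at hder
    exact ⟨by simp [h1], by rw [← hder, derivative_one]⟩
  · rintro ⟨h0, htr⟩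
    refine derivative.ext ?_ ?_
    · rw [hder, htr, mul_zero, derivative_one]
    · simpa using h0

end PowerSeries

theorem stmt14 (n : ℕ) (hn : 1 ≤ n) (R : ℝ) (hR : 0 < R)
    (F : ℂ → Matrix (Fin n) (Fin n) ℂ)
    (Fc Gc : ℕ → Matrix (Fin n) (Fin n) ℂ)
    -- `F(λ)` is invertible on the disk `D(0, R)`:
    (hFinv : ∀ lam : ℂ, ‖lam‖ < R → IsUnit (F lam))
    -- power series expansion `F(λ) = Σⱼ λʲ Fⱼ`, converging on `D(0, R)`:
    (hF : ∀ lam : ℂ, ‖lam‖ < R → HasSum (fun j : ℕ => lam ^ j • Fc j) (F lam))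
    -- power series expansion `F(λ)⁻¹ = Σₖ λᵏ Gₖ`, converging on `D(0, R)`:
    (hG : ∀ lam : ℂ, ‖lam‖ < R → HasSum (fun k : ℕ => lam ^ k • Gc k) (F lam)⁻¹) :
    -- `det F ≡ 1` on `D(0, R)`  ↔  `det F₀ = 1` and the trace identities hold:
    (∀ lam : ℂ, ‖lam‖ < R → (F lam).det = 1) ↔
      ((Fc 0).det = 1 ∧
        ∀ ℓ : ℕ, 1 ≤ ℓ →
          ∑ j ∈ Finset.Icc 1 ℓ, (j : ℂ) * (Fc j * Gc (ℓ - j)).trace = 0) := by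
  have hPQ : PowerSeries.matrixMk Fc * PowerSeries.matrixMk Gc = 1 := by
    ext1 i j
    refine PowerSeries.eq_of_hasSumAt hR (f := fun _ => (1 : Matrix (Fin n) (Fin n) ℂ) i j)
      (fun z hz => ?_) (fun z _ => ?_)
    · rw [← mul_nonsing_inv (F z) ((isUnit_iff_isUnit_det _).1 (hFinv z hz)), mul_apply, mul_apply]
      exact PowerSeries.HasSumAt.sum fun k _ => (PowerSeries.hasSumAt_matrixMk (hF z hz) i k).mul
        (PowerSeries.hasSumAt_matrixMk (hG z hz) k j)
    · rcases eq_or_ne i j with rfl | hij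
      · simpa using PowerSeries.hasSumAt_one z
      · simpa [hij] using PowerSeries.hasSumAt_zero z
  have hdet (z : ℂ) (hz : ‖z‖ < R) :
      PowerSeries.HasSumAt (PowerSeries.matrixMk Fc).det z (F z).det :=
    PowerSeries.HasSumAt.det (PowerSeries.hasSumAt_matrixMk (hF z hz))
  have hone : (∀ z : ℂ, ‖z‖ < R → (F z).det = 1) ↔ (PowerSeries.matrixMk Fc).det = 1 := by
    constructor
    · intro h
      exact PowerSeries.eq_of_hasSumAt hR hdet fun z hz => by
        rw [h z hz]
        exact PowerSeries.hasSumAt_one z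
    · intro h z hz
      exact (h ▸ hdet z hz).unique (PowerSeries.hasSumAt_one z)
  rw [hone, PowerSeries.det_eq_one_iff hPQ, PowerSeries.constantCoeff_det_matrixMk,
    PowerSeries.ext_iff]
  simp only [PowerSeries.coeff_trace_derivative_mul, map_zero]
  refine and_congr_right fun _ => ⟨fun h ℓ hℓ => ?_, fun h m => h (m + 1) (Nat.le_add_left 1 m)⟩
  obtain ⟨m, rfl⟩ := Nat.exists_eq_add_of_le' hℓ
  exact h m
end

section
/- Let A = (A_1,…,A_d) be an irreducible d-tuple of n×n complex matrices, let x ∈ ℂ^n, and define A_j(z) := A_j (I_n + z · x x*) for z ∈ ℂ. Suppose there exists z_0 ∈ ℂ \ {0} such that the tuple A(z_0) = (A_1(z_0),…,A_d(z_0)) is jointly similar to A. Then for every word ω = i_1⋯i_m in {1,…,d} of length m, the polynomial z ↦ tr(A_{i_1}(z) A_{i_2}(z) ⋯ A_{i_m}(z)) has degree at most ⌊m/2⌋; equivalently, the polynomial p_ω(z) := (tr A(z)^ω − tr A^ω)/z has degree at most ⌊m/2⌋ − 1. -/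
open Matrix

/-- The perturbed tuple `A(z)` with `Aⱼ(z) = Aⱼ (I + z · x x*)`. -/
noncomputable def pertTuple {d n : ℕ} (A : Fin d → Matrix (Fin n) (Fin n) ℂ)
    (x : Fin n → ℂ) (z : ℂ) : Fin d → Matrix (Fin n) (Fin n) ℂ :=
  fun j => A j * (1 + z • Matrix.vecMulVec x (star x))

/-- The functions `ℂ → ℂ` given by polynomials of degree at most `k`. -/
def polyFun (k : ℕ) : Submodule ℂ (ℂ → ℂ) where
  carrier := {f | ∃ p : Polynomial ℂ, (∀ z, p.eval z = f z) ∧ p.natDegree ≤ k}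
  add_mem' := by
    rintro f g ⟨p, hp, hpk⟩ ⟨q, hq, hqk⟩
    exact ⟨p + q, fun z => by simp [hp, hq], Polynomial.natDegree_add_le_of_degree_le hpk hqk⟩
  zero_mem' := ⟨0, by simp, by simp⟩
  smul_mem' := by
    rintro c f ⟨p, hp, hpk⟩
    exact ⟨c • p, fun z => by simp [hp], (Polynomial.natDegree_smul_le c p).trans hpk⟩

lemma polyFun_mono {k l : ℕ} (h : k ≤ l) : polyFun k ≤ polyFun l := by
  rintro f ⟨p, hp, hpk⟩
  exact ⟨p, hp, hpk.trans h⟩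

lemma const_mem_polyFun (c : ℂ) (k : ℕ) : (fun _ => c) ∈ polyFun k :=
  ⟨Polynomial.C c, by simp, by simp⟩

lemma id_mul_mem_polyFun {k : ℕ} {f : ℂ → ℂ} (hf : f ∈ polyFun k) :
    (fun z => z * f z) ∈ polyFun (k + 1) := by
  obtain ⟨p, hp, hpk⟩ := hf
  refine ⟨Polynomial.X * p, fun z => by simp [hp], ?_⟩
  have h := Polynomial.natDegree_mul_le (p := (Polynomial.X : Polynomial ℂ)) (q := p)
  rw [Polynomial.natDegree_X] at h
  omega

section Perturbation

variable {d n : ℕ} {A : Fin d → Matrix (Fin n) (Fin n) ℂ} {x : Fin n → ℂ}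

lemma pertTuple_mulVec (z : ℂ) (j : Fin d) (v : Fin n → ℂ) :
    pertTuple A x z j *ᵥ v = A j *ᵥ v + (z * (star x ⬝ᵥ v)) • (A j *ᵥ x) := by
  rw [pertTuple, ← mulVec_mulVec, add_mulVec, one_mulVec, smul_mulVec, vecMulVec_mulVec,
    mulVec_add, mulVec_smul, op_smul_eq_smul, mulVec_smul, smul_smul]

lemma vecMul_pertTuple (z : ℂ) (j : Fin d) (hx : star x ⬝ᵥ A j *ᵥ x = 0) :
    star x ᵥ* pertTuple A x z j = star x ᵥ* A j := by
  rw [pertTuple, ← vecMul_vecMul, vecMul_add, vecMul_one, vecMul_smul, vecMul_vecMulVec,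
    ← dotProduct_mulVec, hx]
  simp

lemma trace_mul_pertTuple (N : Matrix (Fin n) (Fin n) ℂ) (z : ℂ) (j : Fin d) :
    (N * pertTuple A x z j).trace = (N * A j).trace + z * (star x ⬝ᵥ N *ᵥ (A j *ᵥ x)) := by
  rw [pertTuple, ← mul_assoc, mul_add, mul_one, trace_add, Matrix.mul_smul, trace_smul,
    mul_vecMulVec, trace_vecMulVec, mulVec_mulVec, dotProduct_comm, smul_eq_mul]

/-- Joint similarity at a nonzero parameter equates the traces of the letters. -/
lemma star_dotProduct_mulVec_eq_zero
    (hsim : ∃ z₀ : ℂ, z₀ ≠ 0 ∧ JointlySimilar A (pertTuple A x z₀)) (j : Fin d) :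
    star x ⬝ᵥ A j *ᵥ x = 0 := by
  obtain ⟨z₀, hz₀, S, hS, h⟩ := hsim
  have ht : (pertTuple A x z₀ j).trace = (A j).trace := by
    rw [h j, trace_mul_comm, ← mul_assoc, nonsing_inv_mul _ ((isUnit_iff_isUnit_det S).1 hS),
      one_mul]
  have hN := trace_mul_pertTuple (A := A) (x := x) 1 z₀ j
  simp only [one_mul, one_mulVec, ht] at hN
  simpa [hz₀] using hN

/-- Two consecutive copies of `x x*` annihilate each other, so at most every second letter of a
word contributes to the degree. -/
lemma prod_pertTuple_mem_polyFun (hx : ∀ j, star x ⬝ᵥ A j *ᵥ x = 0) (ω : List (Fin d)) :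
    (∀ u v, (fun z => u ⬝ᵥ (ω.map (pertTuple A x z)).prod *ᵥ v) ∈
      polyFun ((ω.length + 1) / 2)) ∧
    ∀ u j, (fun z => u ⬝ᵥ (ω.map (pertTuple A x z)).prod *ᵥ (A j *ᵥ x)) ∈
      polyFun (ω.length / 2) := by
  induction ω using List.reverseRecOn with
  | nil => simp [const_mem_polyFun]
  | append_singleton ω i ih =>
    have step (z : ℂ) (u v : Fin n → ℂ) :
        u ⬝ᵥ ((ω ++ [i]).map (pertTuple A x z)).prod *ᵥ v =
          u ⬝ᵥ (ω.map (pertTuple A x z)).prod *ᵥ (A i *ᵥ v) +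
            (star x ⬝ᵥ v) * (z * (u ⬝ᵥ (ω.map (pertTuple A x z)).prod *ᵥ (A i *ᵥ x))) := by
      rw [List.map_append, List.prod_append, List.map_singleton, List.prod_singleton,
        ← mulVec_mulVec, pertTuple_mulVec, mulVec_add, mulVec_smul, dotProduct_add,
        dotProduct_smul, smul_eq_mul]
      ring
    simp only [step, List.length_append, List.length_singleton, hx, zero_mul, add_zero]
    refine ⟨fun u v => add_mem (polyFun_mono (by omega) (ih.1 u _)) ?_, fun u j => ih.1 u _⟩
    exact polyFun_mono (by omega)
      (Submodule.smul_mem _ (star x ⬝ᵥ v) (id_mul_mem_polyFun (ih.2 u i)))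

lemma trace_prod_pertTuple_mem_polyFun (hx : ∀ j, star x ⬝ᵥ A j *ᵥ x = 0) (ω : List (Fin d)) :
    (fun z => ((ω.map (pertTuple A x z)).prod).trace) ∈ polyFun (ω.length / 2) := by
  induction ω using List.reverseRecOn with
  | nil => simp [const_mem_polyFun]
  | append_singleton ω j _ =>
    simp only [List.map_append, List.prod_append, List.map_singleton, List.prod_singleton,
      trace_mul_pertTuple, List.length_append, List.length_singleton]
    refine add_mem ?_ ?_
    · have trace_eq (N : Matrix (Fin n) (Fin n) ℂ) :
          (N * A j).trace = ∑ k, Pi.single k 1 ⬝ᵥ N *ᵥ (A j *ᵥ Pi.single k 1) := by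
        simp only [mulVec_mulVec]
        simp [trace]
      have hsum := Submodule.sum_mem _ fun k (_ : k ∈ Finset.univ) =>
        (prod_pertTuple_mem_polyFun hx ω).1 (Pi.single k 1) (A j *ᵥ Pi.single k 1)
      convert hsum using 1
      ext z
      rw [trace_eq, Finset.sum_apply]
    · cases ω with
      | nil => simp [hx, const_mem_polyFun]
      | cons i τ =>
        have first (z : ℂ) (v : Fin n → ℂ) :
            star x ⬝ᵥ ((i :: τ).map (pertTuple A x z)).prod *ᵥ v =
              (star x ᵥ* A i) ⬝ᵥ (τ.map (pertTuple A x z)).prod *ᵥ v := by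
          rw [List.map_cons, List.prod_cons, ← mulVec_mulVec, dotProduct_mulVec,
            vecMul_pertTuple z i (hx i)]
        simp only [first, List.length_cons]
        exact polyFun_mono (by omega)
          (id_mul_mem_polyFun ((prod_pertTuple_mem_polyFun hx τ).2 (star x ᵥ* A i) j))

end Perturbation

theorem stmt15 (d n : ℕ) (A : Fin d → Matrix (Fin n) (Fin n) ℂ)
    (hirr : IrreducibleTuple A) (x : Fin n → ℂ)
    (hsim : ∃ z₀ : ℂ, z₀ ≠ 0 ∧ JointlySimilar A (pertTuple A x z₀)) :
    -- for every word `ω` of length `m`, `z ↦ tr(A(z)^ω)` is a polynomial of degree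
    -- at most `⌊m/2⌋`:
    ∀ ω : List (Fin d), ∃ p : Polynomial ℂ,
      (∀ z : ℂ, p.eval z = ((ω.map (pertTuple A x z)).prod).trace) ∧
      p.natDegree ≤ ω.length / 2 := by
  exact trace_prod_pertTuple_mem_polyFun (star_dotProduct_mulVec_eq_zero hsim)
end

section
/- Let A = (A_1,…,A_d) be an irreducible d-tuple of n×n complex matrices, let x ∈ ℂ^n, define A_j(z) := A_j(I_n + z · x x*), and let S_A := { z ∈ ℂ \ {0} : the tuple A(z) is jointly similar to A }. If S_A has at least n²/2 elements (i.e., S_A is infinite or its cardinality k satisfies 2k ≥ n²), then A(z) is jointly similar to A for every z ∈ ℂ. -/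
open Matrix

/-- If a pencil `P + z • R ∘ C` of linear maps, whose leading term factors through a space `U`,
has a nontrivial kernel for more than `dim U` values of `z`, then it does so for every `z`. -/
theorem exists_ne_zero_pencil_eq_zero {K V W U : Type*} [Field K]
    [AddCommGroup V] [Module K V] [AddCommGroup W] [Module K W]
    [AddCommGroup U] [Module K U] [FiniteDimensional K U]
    (P : V →ₗ[K] W) (R : U →ₗ[K] W) (C : V →ₗ[K] U) (s : Finset K)
    (hs : Module.finrank K U < s.card)
    (hker : ∀ z ∈ s, ∃ v, v ≠ 0 ∧ P v + z • R (C v) = 0) (z₀ : K) :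
    ∃ v, v ≠ 0 ∧ P v + z₀ • R (C v) = 0 := by
  by_contra! hcon
  have hinj : LinearMap.ker (P + z₀ • R ∘ₗ C) = ⊥ := by
    rw [LinearMap.ker_eq_bot']
    intro v hv
    by_contra hne
    exact hcon v hne (by simpa using hv)
  obtain ⟨T, hT⟩ := LinearMap.exists_leftInverse_of_injective _ hinj
  have hTv : ∀ v, T (P v + z₀ • R (C v)) = v := fun v => by
    simpa using LinearMap.congr_fun hT v
  choose! v hv0 hv using hker
  have hne : ∀ z ∈ s, z - z₀ ≠ 0 := by
    intro z hz h
    rw [sub_eq_zero] at h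
    subst h
    exact hcon _ (hv0 z hz) (hv z hz)
  have hfix : ∀ z ∈ s, v z = -(z - z₀) • T (R (C (v z))) := by
    intro z hz
    have h : P (v z) + z₀ • R (C (v z)) = -(z - z₀) • R (C (v z)) := by
      rw [eq_neg_of_add_eq_zero_left (hv z hz)]
      module
    calc v z = T (P (v z) + z₀ • R (C (v z))) := (hTv _).symm
      _ = _ := by rw [h, map_smul]
  have heig : ∀ z : s, Module.End.HasEigenvector (C ∘ₗ T ∘ₗ R) (-(z.1 - z₀))⁻¹ (C (v z)) := by
    rintro ⟨z, hz⟩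
    refine ⟨Module.End.mem_eigenspace_iff.2 ?_, fun h => hv0 z hz ?_⟩
    · have h := congrArg C (hfix z hz)
      rw [map_smul] at h
      rw [eq_inv_smul_iff₀ (neg_ne_zero.2 (hne z hz))]
      exact h.symm
    · rw [hfix z hz]
      simp only at h
      simp [h]
  have hli := Module.End.eigenvectors_linearIndependent' (C ∘ₗ T ∘ₗ R)
    (fun z : s => (-(z.1 - z₀))⁻¹)
    (fun a b hab => Subtype.ext (sub_left_injective (neg_injective (inv_injective hab)))) _ heig
  have := hli.fintype_card_le_finrank
  rw [Fintype.card_coe] at this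
  omega

/-- A nonzero matrix intertwining an irreducible tuple with another tuple is invertible. -/
theorem IrreducibleTuple.isUnit_of_intertwines {d n : ℕ}
    {A B : Fin d → Matrix (Fin n) (Fin n) ℂ} (hA : IrreducibleTuple A)
    {S : Matrix (Fin n) (Fin n) ℂ} (hS : S ≠ 0) (h : ∀ j, B j * S = S * A j) : IsUnit S := by
  have hinv : ∀ j, ∀ v ∈ LinearMap.ker S.mulVecLin, (A j).mulVec v ∈ LinearMap.ker S.mulVecLin := by
    intro j v hv
    rw [LinearMap.mem_ker, mulVecLin_apply] at hv ⊢
    rw [mulVec_mulVec, ← h, ← mulVec_mulVec, hv, mulVec_zero]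
  rcases hA _ hinv with hbot | htop
  · exact mulVec_injective_iff_isUnit.1 (LinearMap.ker_eq_bot.1 hbot)
  · refine absurd ?_ hS
    rw [LinearMap.ker_eq_top] at htop
    exact Matrix.toLin'.injective (by rw [map_zero]; exact htop)

/-- Joint similarity to an irreducible tuple is witnessed by any nonzero intertwiner. -/
theorem IrreducibleTuple.jointlySimilar_iff {d n : ℕ} [NeZero n]
    {A B : Fin d → Matrix (Fin n) (Fin n) ℂ} (hA : IrreducibleTuple A) :
    JointlySimilar A B ↔ ∃ S, S ≠ 0 ∧ ∀ j, B j * S = S * A j := by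
  constructor
  · rintro ⟨S, hS, h⟩
    refine ⟨S, hS.ne_zero, fun j => ?_⟩
    rw [h, nonsing_inv_mul_cancel_right _ _ ((isUnit_iff_isUnit_det S).1 hS)]
  · rintro ⟨S, hS0, h⟩
    have hS := hA.isUnit_of_intertwines hS0 h
    refine ⟨S, hS, fun j => ?_⟩
    rw [← h, mul_nonsing_inv_cancel_right _ _ ((isUnit_iff_isUnit_det S).1 hS)]

theorem stmt16 (d n : ℕ) (A : Fin d → Matrix (Fin n) (Fin n) ℂ)
    (hirr : IrreducibleTuple A) (x : Fin n → ℂ)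
    -- `S_A = { z ≠ 0 : A(z) is jointly similar to A }` has at least `n²/2` elements:
    (hcard : {z : ℂ | z ≠ 0 ∧ JointlySimilar A (pertTuple A x z)}.Infinite ∨
      n ^ 2 ≤ 2 * {z : ℂ | z ≠ 0 ∧ JointlySimilar A (pertTuple A x z)}.ncard) :
    ∀ z : ℂ, JointlySimilar A (pertTuple A x z) := by
  rcases Nat.eq_zero_or_pos n with rfl | hn
  · exact fun z => ⟨1, isUnit_one, fun j => Subsingleton.elim _ _⟩
  have : NeZero n := ⟨hn.ne'⟩
  obtain ⟨t, ht, htcard⟩ : ∃ t : Finset ℂ,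
      (t : Set ℂ) ⊆ {z : ℂ | z ≠ 0 ∧ JointlySimilar A (pertTuple A x z)} ∧ t.card = n := by
    by_cases hinf : {z : ℂ | z ≠ 0 ∧ JointlySimilar A (pertTuple A x z)}.Infinite
    · exact hinf.exists_subset_card_eq n
    · have hcard' := hcard.resolve_left hinf
      have hfin := Set.not_infinite.1 hinf
      rw [Set.ncard_eq_toFinset_card _ hfin] at hcard'
      obtain ⟨t, ht, htn⟩ := Finset.exists_subset_card_eq (s := hfin.toFinset) (n := n) (by nlinarith)
      exact ⟨t, fun z hz => hfin.mem_toFinset.1 (ht hz), htn⟩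
  let P : Matrix (Fin n) (Fin n) ℂ →ₗ[ℂ] (Fin d → Matrix (Fin n) (Fin n) ℂ) :=
    LinearMap.pi fun j => LinearMap.mulLeft ℂ (A j) - LinearMap.mulRight ℂ (A j)
  let R : (Fin n → ℂ) →ₗ[ℂ] (Fin d → Matrix (Fin n) (Fin n) ℂ) :=
    LinearMap.pi fun j => LinearMap.mulLeft ℂ (A j) ∘ₗ vecMulVecBilin ℂ ℂ x
  let C : Matrix (Fin n) (Fin n) ℂ →ₗ[ℂ] (Fin n → ℂ) := vecMulBilin ℂ ℂ (star x)
  have hpencil : ∀ z, JointlySimilar A (pertTuple A x z) ↔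
      ∃ S, S ≠ 0 ∧ P S + z • R (C S) = 0 := by
    intro z
    rw [hirr.jointlySimilar_iff]
    refine exists_congr fun S => and_congr_right fun _ => ?_
    rw [funext_iff]
    refine forall_congr' fun j => ?_
    have : (P S + z • R (C S)) j = pertTuple A x z j * S - S * A j := by
      simp [P, R, C, pertTuple, mul_add, add_mul, mul_assoc, vecMulVec_mul]
      abel
    rw [this, Pi.zero_apply, sub_eq_zero]
  intro z
  rw [hpencil]
  refine exists_ne_zero_pencil_eq_zero P R C (insert 0 t) ?_ (fun w hw => ?_) z
  · rw [Finset.card_insert_of_notMem fun h => (ht h).1 rfl, htcard]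
    simp
  · rw [← hpencil]
    rcases Finset.mem_insert.1 hw with rfl | hw
    · exact ⟨1, isUnit_one, fun j => by simp [pertTuple]⟩
    · exact (ht hw).2
end
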